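/- arXiv:2401.01287 — 2 statements merged into one kernel-verified Lean document; each statement's English description precedes it below -/
import Mathlib

section
/- The operator X⊗X⊗X⊗X⊗X on (ℂ²)^⊗5 acts as the logical X operator of the five-qubit code: (X⊗X⊗X⊗X⊗X)|0̄⟩ = |1̄⟩ and (X⊗X⊗X⊗X⊗X)|1̄⟩ = |0̄⟩. Equivalently, with T : ℂ² → (ℂ²)^⊗5 the encoding isometry T|0⟩ = |0̄⟩, T|1⟩ = |1̄⟩, one has (X⊗X⊗X⊗X⊗X) ∘ T = T ∘ X. -/
open scoped Matrix Kronecker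

/-- The Pauli matrix `X`. -/
def pauliX : Matrix (Fin 2) (Fin 2) ℂ := !![0, 1; 1, 0]

/-- The Pauli matrix `Y`. -/
def pauliY : Matrix (Fin 2) (Fin 2) ℂ := !![0, -Complex.I; Complex.I, 0]

/-- The Pauli matrix `Z`. -/
def pauliZ : Matrix (Fin 2) (Fin 2) ℂ := !![1, 0; 0, -1]

/-- The index type of five qubits, `(ℂ²)^⊗5 ≅ ℂ^(2⁵)`. -/
abbrev Q5 : Type := Fin 2 × Fin 2 × Fin 2 × Fin 2 × Fin 2

/-- Five-fold Kronecker product of `2×2` matrices, a `32×32` matrix. -/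
def kron5 (A B C D E : Matrix (Fin 2) (Fin 2) ℂ) : Matrix Q5 Q5 ℂ :=
  A ⊗ₖ (B ⊗ₖ (C ⊗ₖ (D ⊗ₖ E)))

/-- The computational basis vector `|a⟩` of `ℂ²`. -/
def ket (a : Fin 2) : Fin 2 → ℂ := fun i => if i = a then 1 else 0

/-- The computational basis vector `|abcde⟩` of `(ℂ²)^⊗5`. -/
def ket5 (a b c d e : Fin 2) : Q5 → ℂ :=
  fun x => ket a x.1 * ket b x.2.1 * ket c x.2.2.1 * ket d x.2.2.2.1 * ket e x.2.2.2.2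

/-- The logical state `|0̄⟩` of the five-qubit code. -/
noncomputable def logicalZero : Q5 → ℂ :=
  ((1 : ℂ) / 4) •
    (ket5 0 0 0 0 0 + ket5 1 0 0 1 0 + ket5 0 1 0 0 1 + ket5 1 0 1 0 0 + ket5 0 1 0 1 0
      - ket5 1 1 0 1 1 - ket5 0 0 1 1 0 - ket5 1 1 0 0 0 - ket5 1 1 1 0 1 - ket5 0 0 0 1 1
      - ket5 1 1 1 1 0 - ket5 0 1 1 1 1 - ket5 1 0 0 0 1 - ket5 0 1 1 0 0 - ket5 1 0 1 1 1
      + ket5 0 0 1 0 1)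

/-- The logical state `|1̄⟩` of the five-qubit code. -/
noncomputable def logicalOne : Q5 → ℂ :=
  ((1 : ℂ) / 4) •
    (ket5 1 1 1 1 1 + ket5 0 1 1 0 1 + ket5 1 0 1 1 0 + ket5 0 1 0 1 1 + ket5 1 0 1 0 1
      - ket5 0 0 1 0 0 - ket5 1 1 0 0 1 - ket5 0 0 1 1 1 - ket5 0 0 0 1 0 - ket5 1 1 1 0 0
      - ket5 0 0 0 0 1 - ket5 1 0 0 0 0 - ket5 0 1 1 1 0 - ket5 1 0 0 1 1 - ket5 0 1 0 0 0
      + ket5 1 1 0 1 0)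

/-- The encoding matrix `T : ℂ² → (ℂ²)^⊗5` of the five-qubit code, with
columns `|0̄⟩` and `|1̄⟩`. -/
noncomputable def encT : Matrix Q5 (Fin 2) ℂ :=
  Matrix.of fun x i => if i = 0 then logicalZero x else logicalOne x

theorem ket5_eq_single (a b c d e : Fin 2) : ket5 a b c d e = Pi.single (a, b, c, d, e) 1 := by
  ext y
  simp only [ket5, ket, Pi.single_apply, Prod.ext_iff, ite_and, mul_ite, mul_one, mul_zero]
  split_ifs <;> simp_all

theorem kron5_mulVec_ket5 (A B C D E : Matrix (Fin 2) (Fin 2) ℂ) (a b c d e : Fin 2) :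
    (kron5 A B C D E).mulVec (ket5 a b c d e) = fun x =>
      A x.1 a * (B x.2.1 b * (C x.2.2.1 c * (D x.2.2.2.1 d * E x.2.2.2.2 e))) := by
  rw [ket5_eq_single, Matrix.mulVec_single_one]
  rfl

theorem pauliX_apply (i a : Fin 2) : pauliX i a = ket (1 - a) i := by
  fin_cases i <;> fin_cases a <;> simp [pauliX, ket]

theorem kron5_pauliX_mulVec_ket5 (a b c d e : Fin 2) :
    (kron5 pauliX pauliX pauliX pauliX pauliX).mulVec (ket5 a b c d e) =
      ket5 (1 - a) (1 - b) (1 - c) (1 - d) (1 - e) := by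
  ext x
  simp only [kron5_mulVec_ket5, pauliX_apply, ket5, mul_assoc]

theorem kron5_pauliX_mulVec_logicalZero :
    (kron5 pauliX pauliX pauliX pauliX pauliX).mulVec logicalZero = logicalOne := by
  simp only [logicalZero, logicalOne, Matrix.mulVec_smul, Matrix.mulVec_add, Matrix.mulVec_sub,
    kron5_pauliX_mulVec_ket5, sub_zero, sub_self]

theorem kron5_pauliX_mulVec_logicalOne :
    (kron5 pauliX pauliX pauliX pauliX pauliX).mulVec logicalOne = logicalZero := by
  simp only [logicalZero, logicalOne, Matrix.mulVec_smul, Matrix.mulVec_add, Matrix.mulVec_sub,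
    kron5_pauliX_mulVec_ket5, sub_zero, sub_self]

/-- `X⊗X⊗X⊗X⊗X` is the logical `X` operator of the
five-qubit code: it swaps `|0̄⟩` and `|1̄⟩`; equivalently
`(X⊗X⊗X⊗X⊗X) ∘ T = T ∘ X`. -/
theorem logical_X_operator :
    (kron5 pauliX pauliX pauliX pauliX pauliX).mulVec logicalZero = logicalOne ∧
    (kron5 pauliX pauliX pauliX pauliX pauliX).mulVec logicalOne = logicalZero ∧
    kron5 pauliX pauliX pauliX pauliX pauliX * encT = encT * pauliX := by
  refine ⟨kron5_pauliX_mulVec_logicalZero, kron5_pauliX_mulVec_logicalOne, ?_⟩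
  ext x i
  fin_cases i
  · simpa [Matrix.mul_apply, encT, pauliX, Matrix.mulVec, dotProduct] using
      congrFun kron5_pauliX_mulVec_logicalZero x
  · simpa [Matrix.mul_apply, encT, pauliX, Matrix.mulVec, dotProduct] using
      congrFun kron5_pauliX_mulVec_logicalOne x
end

section
/- The five-qubit code satisfies the Knill–Laflamme conditions for arbitrary single-qubit errors: for any two operators E and F on (ℂ²)^⊗5, each of which is a single-qubit Pauli error (a Kronecker product of one Pauli matrix X, Y, or Z in one tensor factor and identities elsewhere) or the identity, one has ⟨0̄| E†F |1̄⟩ = 0 and ⟨0̄| E†F |0̄⟩ = ⟨1̄| E†F |1̄⟩. -/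
open scoped Matrix Kronecker

/-- The operator acting as `P` on qubit `i` and as the identity elsewhere. -/
def singleQubitOp (i : Fin 5) (P : Matrix (Fin 2) (Fin 2) ℂ) : Matrix Q5 Q5 ℂ :=
  kron5 (if i = 0 then P else 1) (if i = 1 then P else 1) (if i = 2 then P else 1)
    (if i = 3 then P else 1) (if i = 4 then P else 1)

/-- `E` is a single-qubit Pauli error (one factor `X`, `Y` or `Z`, identities
elsewhere) or the identity. -/
def IsPauliErrorOrId (E : Matrix Q5 Q5 ℂ) : Prop :=
  E = 1 ∨ ∃ (i : Fin 5) (P : Matrix (Fin 2) (Fin 2) ℂ),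
    (P = pauliX ∨ P = pauliY ∨ P = pauliZ) ∧ E = singleQubitOp i P

/-- The inner product `⟨v|w⟩` on `(ℂ²)^⊗5`. -/
noncomputable def braket (v w : Q5 → ℂ) : ℂ := ∑ x : Q5, star (v x) * w x

/-- The action of `P` on qubit `i` of a vector of `R^(2⁵)`. -/
def actOnQubit {R : Type*} [CommRing R] (i : Fin 5) (P : Matrix (Fin 2) (Fin 2) R)
    (v : Q5 → R) : Q5 → R :=
  fun (a, b, c, d, e) =>
    match i with
    | 0 => P a 0 * v (0, b, c, d, e) + P a 1 * v (1, b, c, d, e)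
    | 1 => P b 0 * v (a, 0, c, d, e) + P b 1 * v (a, 1, c, d, e)
    | 2 => P c 0 * v (a, b, 0, d, e) + P c 1 * v (a, b, 1, d, e)
    | 3 => P d 0 * v (a, b, c, 0, e) + P d 1 * v (a, b, c, 1, e)
    | 4 => P e 0 * v (a, b, c, d, 0) + P e 1 * v (a, b, c, d, 1)

theorem singleQubitOp_mulVec (i : Fin 5) (P : Matrix (Fin 2) (Fin 2) ℂ) (v : Q5 → ℂ) :
    singleQubitOp i P *ᵥ v = actOnQubit i P v := by
  ext ⟨a, b, c, d, e⟩
  fin_cases i <;>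
    simp [singleQubitOp, kron5, actOnQubit, Matrix.mulVec, dotProduct, Fintype.sum_prod_type,
      Matrix.one_apply, -Fin.sum_univ_two] <;>
    simp

theorem actOnQubit_smul_matrix {R : Type*} [CommRing R] (i : Fin 5) (c : R)
    (P : Matrix (Fin 2) (Fin 2) R) (v : Q5 → R) :
    actOnQubit i (c • P) v = c • actOnQubit i P v := by
  ext x
  fin_cases i <;> simp [actOnQubit] <;> ring

theorem actOnQubit_smul_vec {R : Type*} [CommRing R] (i : Fin 5) (c : R)
    (P : Matrix (Fin 2) (Fin 2) R) (v : Q5 → R) :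
    actOnQubit i P (c • v) = c • actOnQubit i P v := by
  ext x
  fin_cases i <;> simp [actOnQubit] <;> ring

theorem actOnQubit_intCast (i : Fin 5) (P : Matrix (Fin 2) (Fin 2) ℤ) (v : Q5 → ℤ) :
    actOnQubit i (P.map (Int.cast : ℤ → ℂ)) (fun x => (v x : ℂ)) =
      fun x => ((actOnQubit i P v x : ℤ) : ℂ) := by
  ext x
  fin_cases i <;> simp [actOnQubit]

/-- Integer representatives, up to a phase, of the identity and the Pauli matrices. -/
def intPauli : Fin 4 → Matrix (Fin 2) (Fin 2) ℤ :=
  ![!![1, 0; 0, 1], !![0, 1; 1, 0], !![0, -1; 1, 0], !![1, 0; 0, -1]]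

theorem singleQubitOp_one (i : Fin 5) : singleQubitOp i 1 = 1 := by
  simp [singleQubitOp, kron5]

theorem IsPauliErrorOrId.exists_mulVec_eq {E : Matrix Q5 Q5 ℂ} (hE : IsPauliErrorOrId E) :
    ∃ (c : ℂ) (i : Fin 5) (p : Fin 4), ∀ v : Q5 → ℂ,
      E *ᵥ v = c • actOnQubit i ((intPauli p).map (Int.cast : ℤ → ℂ)) v := by
  suffices ∃ (c : ℂ) (i : Fin 5) (p : Fin 4),
      E = singleQubitOp i (c • (intPauli p).map (Int.cast : ℤ → ℂ)) by
    obtain ⟨c, i, p, rfl⟩ := this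
    exact ⟨c, i, p, fun v => by rw [singleQubitOp_mulVec, actOnQubit_smul_matrix]⟩
  rcases hE with rfl | ⟨i, P, rfl | rfl | rfl, rfl⟩
  · refine ⟨1, 0, 0, ?_⟩
    rw [← singleQubitOp_one 0]
    congr 1
    ext a b
    fin_cases a <;> fin_cases b <;> simp [intPauli]
  · refine ⟨1, i, 1, ?_⟩
    congr 1
    ext a b
    fin_cases a <;> fin_cases b <;> simp [intPauli, pauliX]
  · refine ⟨Complex.I, i, 2, ?_⟩
    congr 1
    ext a b
    fin_cases a <;> fin_cases b <;> simp [intPauli, pauliY]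
  · refine ⟨1, i, 3, ?_⟩
    congr 1
    ext a b
    fin_cases a <;> fin_cases b <;> simp [intPauli, pauliZ]

/-- Four times the amplitudes of the logical state `s`: the basis vectors of weight congruent to
`s` modulo 2, with sign given by the number of cyclically adjacent pairs of ones. -/
def codeAmplitude (s : Fin 2) : Q5 → ℤ :=
  fun (a, b, c, d, e) =>
    if a + b + c + d + e = s then
      if a * b + b * c + c * d + d * e + e * a = s then 1 else -1
    else 0

theorem logicalZero_eq :
    logicalZero = ((1 : ℂ) / 4) • fun x => (codeAmplitude 0 x : ℂ) := by
  unfold logicalZero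
  congr 1
  ext ⟨a, b, c, d, e⟩
  fin_cases a <;> fin_cases b <;> fin_cases c <;> fin_cases d <;> fin_cases e <;>
    simp [ket5, ket, codeAmplitude]

theorem logicalOne_eq :
    logicalOne = ((1 : ℂ) / 4) • fun x => (codeAmplitude 1 x : ℂ) := by
  unfold logicalOne
  congr 1
  ext ⟨a, b, c, d, e⟩
  fin_cases a <;> fin_cases b <;> fin_cases c <;> fin_cases d <;> fin_cases e <;>
    simp [ket5, ket, codeAmplitude]

theorem actOnQubit_codeAmplitude_dotProduct (i j : Fin 5) (p q : Fin 4) :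
    actOnQubit i (intPauli p) (codeAmplitude 0) ⬝ᵥ
        actOnQubit j (intPauli q) (codeAmplitude 1) = 0 ∧
      actOnQubit i (intPauli p) (codeAmplitude 0) ⬝ᵥ
        actOnQubit j (intPauli q) (codeAmplitude 0) =
      actOnQubit i (intPauli p) (codeAmplitude 1) ⬝ᵥ
        actOnQubit j (intPauli q) (codeAmplitude 1) := by
  revert i j p q
  decide +kernel

theorem braket_eq_dotProduct (v w : Q5 → ℂ) : braket v w = star v ⬝ᵥ w := rfl

theorem braket_conjTranspose_mul_mulVec (E F : Matrix Q5 Q5 ℂ) (v w : Q5 → ℂ) :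
    braket v ((Eᴴ * F) *ᵥ w) = braket (E *ᵥ v) (F *ᵥ w) := by
  rw [braket_eq_dotProduct, braket_eq_dotProduct, Matrix.star_mulVec, ← Matrix.mulVec_mulVec,
    Matrix.dotProduct_mulVec]

theorem braket_smul_intCast (a b : ℂ) (v w : Q5 → ℤ) :
    braket (a • fun x => (v x : ℂ)) (b • fun x => (w x : ℂ)) =
      star a * b * ((v ⬝ᵥ w : ℤ) : ℂ) := by
  simp only [braket, dotProduct, Int.cast_sum, Finset.mul_sum]
  refine Finset.sum_congr rfl fun x _ => ?_
  simp
  ring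

/-- The five-qubit code satisfies the Knill–Laflamme
conditions for arbitrary single-qubit Pauli errors: for all such `E`, `F`,
`⟨0̄|E†F|1̄⟩ = 0` and `⟨0̄|E†F|0̄⟩ = ⟨1̄|E†F|1̄⟩`. -/
theorem knill_laflamme_five_qubit_code :
    ∀ E F : Matrix Q5 Q5 ℂ, IsPauliErrorOrId E → IsPauliErrorOrId F →
      braket logicalZero ((Eᴴ * F).mulVec logicalOne) = 0 ∧
      braket logicalZero ((Eᴴ * F).mulVec logicalZero) =
        braket logicalOne ((Eᴴ * F).mulVec logicalOne) := by
  intro E F hE hF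
  obtain ⟨c, i, p, hE⟩ := hE.exists_mulVec_eq
  obtain ⟨d, j, q, hF⟩ := hF.exists_mulVec_eq
  obtain ⟨h_orthogonal, h_norm⟩ := actOnQubit_codeAmplitude_dotProduct i j p q
  simp only [braket_conjTranspose_mul_mulVec, hE, hF, logicalZero_eq, logicalOne_eq,
    actOnQubit_smul_vec, actOnQubit_intCast, smul_smul, braket_smul_intCast, h_orthogonal,
    h_norm, Int.cast_zero, mul_zero, and_self]
end
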